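/- Fix an integer m ≥ 3. Let q₁, …, q_M (with M ≥ 1) be distinct prime powers such that for every prime power p^α not in {q₁, …, q_M} one has prm(m;p^α) = prm(m;p^{α+1}), and suppose they are ordered so that prm(m;q₁) ≥ prm(m;q₂) ≥ ⋯ ≥ prm(m;q_M). For 1 ≤ i ≤ M set d_i = lcm(q₁, …, q_i). Then the unit group (ℤ/mℤ)^× is isomorphic as a group to the direct product (∏_{i=1}^{M−1} (ℤ/d_iℤ)^{prm(m;q_i) − prm(m;q_{i+1})}) × (ℤ/d_Mℤ)^{prm(m;q_M)}, where (ℤ/dℤ)^e denotes the direct product of e copies of the additive cyclic group ℤ/dℤ. -/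

import Mathlib

open MeasureTheory ProbabilityTheory Filter

noncomputable section

/-- A key encoding the lexicographic order on pairs `(φ(q), q)`; this is a valid
encoding on prime powers since every prime power satisfies `q ≤ 2 * φ(q)`. -/
def ppKey (q : ℕ) : ℕ := 2 * Nat.totient q ^ 2 + q

/-- The `n`-th smallest key of a prime power (0-indexed). -/
def ppNthKey (n : ℕ) : ℕ := Nat.nth (fun k => ∃ q : ℕ, IsPrimePow q ∧ ppKey q = k) n

/-- The total φ-sequence `q̃_i` (1-indexed): the enumeration of all prime powers
ordered by nondecreasing totient, with ties broken by increasing size. -/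
def qt (i : ℕ) : ℕ := sInf {q : ℕ | IsPrimePow q ∧ ppKey q = ppNthKey (i - 1)}

/-- `lcm(q̃_1, …, q̃_i)`. -/
def Lseq (i : ℕ) : ℕ := (Finset.Icc 1 i).lcm qt

/-- The universal factor order set `f_i`. -/
def UFO (i : ℕ) : Set ℕ :=
  if Nat.totient (qt i) < Nat.totient (qt (i + 1)) then {Lseq i}
  else {Lseq i, Nat.lcm (Lseq (i - 1)) (qt (i + 1))}

/-- `φ(q̃_i)` as a real number. -/
def phiQ (i : ℕ) : ℝ := (Nat.totient (qt i) : ℝ)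

/-- `μ_i = 1/φ(q̃_i) − 1/φ(q̃_{i+1})`. -/
def muSeq (i : ℕ) : ℝ := 1 / phiQ i - 1 / phiQ (i + 1)

/-- `σ_i = (1/φ(q̃_i) + 1/φ(q̃_{i+1}) − 2/(φ(q̃_i)·φ(q̃_{i+1})))^{1/2}`. -/
def sigSeq (i : ℕ) : ℝ :=
  Real.sqrt (1 / phiQ i + 1 / phiQ (i + 1) - 2 / (phiQ i * phiQ (i + 1)))

/-- `σ_{i;a,b} = (φ(q̃_i)^{−a} + φ(q̃_{i+1})^{−b} − 2/(φ(q̃_i)·φ(q̃_{i+1})))^{1/2}`. -/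
def sigAB (i a b : ℕ) : ℝ :=
  Real.sqrt (1 / phiQ i ^ a + 1 / phiQ (i + 1) ^ b - 2 / (phiQ i * phiQ (i + 1)))

/-- `ν_j = (φ(q̃_j)^{−1}·(1 − φ(q̃_j)^{−1}))^{1/2}`. -/
def nuSeq (j : ℕ) : ℝ := Real.sqrt (1 / phiQ j * (1 - 1 / phiQ j))

/-- `J` is an invariant-factor count function for `d`: whenever `(ℤ/mℤ)ˣ` is isomorphic to
a direct product of cyclic groups `ℤ/λ_1 × ⋯ × ℤ/λ_K` with `1 < λ_1 ∣ λ_2 ∣ ⋯ ∣ λ_K`,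
`J m` is the number of indices `j` with `λ_j = d`. -/
def IsInvCount (d : ℕ) (J : ℕ → ℕ) : Prop :=
  ∀ m : ℕ, 1 ≤ m → ∀ K : ℕ, ∀ lam : Fin K → ℕ,
    (∀ j, 1 < lam j) →
    (∀ j k : Fin K, j ≤ k → lam j ∣ lam k) →
    Nonempty ((ZMod m)ˣ ≃* Multiplicative (∀ j : Fin K, ZMod (lam j))) →
    J m = (Finset.univ.filter fun j : Fin K => lam j = d).card

/-- The number of `m ∈ {1, …, n}` satisfying `P`. -/
def cnt (P : ℕ → Prop) (n : ℕ) : ℕ := {m : ℕ | 1 ≤ m ∧ m ≤ n ∧ P m}.ncard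

/-- The average `(1/n)·∑_{m=1}^n J(m)`. -/
def avg (J : ℕ → ℕ) (n : ℕ) : ℝ := (∑ m ∈ Finset.Icc 1 n, (J m : ℝ)) / n

/-- `log log n`. -/
def LL (n : ℕ) : ℝ := Real.log (Real.log n)

/-- The standard normal cumulative distribution function. -/
def Phi (x : ℝ) : ℝ := (Real.sqrt (2 * Real.pi))⁻¹ * ∫ t in Set.Iic x, Real.exp (-t ^ 2 / 2)

/-- Owen's T-function. -/
def OwenT (h a : ℝ) : ℝ :=
  (2 * Real.pi)⁻¹ * ∫ t in (0:ℝ)..a, Real.exp (-(1 + t ^ 2) * h ^ 2 / 2) / (1 + t ^ 2)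

/-- The skew-normal cumulative distribution function with parameter `α`. -/
def PhiSkew (x α : ℝ) : ℝ := Phi x - 2 * OwenT x α

/-- The standard Gaussian probability measure `γ^k` on `ℝ^k`. -/
def stdGaussian (k : ℕ) : Measure (Fin k → ℝ) :=
  Measure.pi fun _ => gaussianReal 0 1

/-- `ω(m;q,1)`: the number of distinct primes `p ∣ m` with `p ≡ 1 (mod q)`. -/
def omegaQ (m q : ℕ) : ℕ := (m.primeFactors.filter fun p => p % q = 1 % q).card

/-- The correction term `Ē(m;p^α)`. -/
def Ebar (m p α : ℕ) : ℕ :=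
  if p ^ α = 2 ∧ 8 ∣ m then 2
  else if p ^ α = 2 ∧ 4 ∣ m ∧ ¬(8 ∣ m) then 1
  else if p = 2 ∧ 2 ≤ α ∧ 2 ^ (α + 2) ∣ m then 1
  else if p ≠ 2 ∧ p ^ (α + 1) ∣ m then 1
  else 0

/-- `prm(m;q)` for a prime power `q = p^α`: the unique `k` such that `p^k` is the cardinality
of the subgroup `{x ∈ (ℤ/mℤ)ˣ : x^p = 1 and x = y^{p^{α−1}} for some y}` (obtained here as the
`p`-adic valuation of that cardinality; note `p = q.minFac` and `p^{α−1} = q / p`). -/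
def prm (m q : ℕ) : ℕ :=
  (Nat.card {x : (ZMod m)ˣ // x ^ q.minFac = 1 ∧ ∃ y : (ZMod m)ˣ, y ^ (q / q.minFac) = x}).factorization
    q.minFac

/-- `m` is `y`-typical: for all prime powers `q₁, q₂` with `φ(q₁) ≤ y` and `φ(q₁) < φ(q₂)`
one has `prm(m;q₁) > prm(m;q₂)`. -/
def yTypical (y : ℝ) (m : ℕ) : Prop :=
  ∀ q₁ q₂ : ℕ, IsPrimePow q₁ → IsPrimePow q₂ →
    (Nat.totient q₁ : ℝ) ≤ y → Nat.totient q₁ < Nat.totient q₂ →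
    prm m q₂ < prm m q₁


/-- The exponent of `p` in the cardinality of `A[p] ∩ p ^ a A`; for a finite abelian group `A` this
is the number of elementary divisors of `A` divisible by `p ^ (a + 1)`. -/
def primaryRank (A : Type*) [AddCommGroup A] (p a : ℕ) : ℕ :=
  (Nat.card {x : A // p • x = 0 ∧ ∃ y : A, p ^ a • y = x}).factorization p

theorem prm_prime_pow_succ (m : ℕ) {p : ℕ} (hp : p.Prime) (a : ℕ) :
    prm m (p ^ (a + 1)) = primaryRank (Additive (ZMod m)ˣ) p a := by
  have h₁ : (p ^ (a + 1)).minFac = p := hp.pow_minFac a.succ_ne_zero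
  have h₂ : p ^ (a + 1) / p = p ^ a := by
    rw [pow_succ, Nat.mul_div_cancel _ hp.pos]
  unfold prm primaryRank
  rw [h₁, h₂]
  rfl

theorem primaryRank_congr {A B : Type*} [AddCommGroup A] [AddCommGroup B] (e : A ≃+ B) (p a : ℕ) :
    primaryRank A p a = primaryRank B p a := by
  unfold primaryRank
  congr 1
  refine congrArg _ (Nat.card_congr (e.toEquiv.subtypeEquiv fun x => ?_))
  refine and_congr ?_ ⟨?_, ?_⟩
  · change _ ↔ p • e x = 0
    rw [← map_nsmul, e.map_eq_zero_iff]
  · rintro ⟨y, rfl⟩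
    exact ⟨e y, (map_nsmul e _ _).symm⟩
  · rintro ⟨y, hy⟩
    refine ⟨e.symm y, ?_⟩
    rw [← map_nsmul, hy]
    exact e.symm_apply_apply x

theorem card_nsmul_eq_zero_mem_range_pi {J : Type*} [Fintype J] {A : J → Type*}
    [∀ j, AddCommGroup (A j)] (p k : ℕ) :
    Nat.card {x : ∀ j, A j // p • x = 0 ∧ ∃ y : ∀ j, A j, k • y = x} =
      ∏ j, Nat.card {x : A j // p • x = 0 ∧ ∃ y : A j, k • y = x} := by
  rw [← Nat.card_pi]
  refine Nat.card_congr (Equiv.trans (Equiv.subtypeEquivRight fun x => ?_)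
    (Equiv.subtypePiEquivPi (p := fun j (x : A j) => p • x = 0 ∧ ∃ y : A j, k • y = x)))
  rw [forall_and, Classical.skolem]
  simp only [funext_iff, Pi.smul_apply, Pi.zero_apply]

theorem card_nsmul_eq_zero_mem_range_zmod {p n : ℕ} (hp : p.Prime) (hn : n ≠ 0) (a : ℕ) :
    Nat.card {x : ZMod n // p • x = 0 ∧ ∃ y : ZMod n, p ^ a • y = x} =
      if p ^ (a + 1) ∣ n then p else 1 := by
  have : NeZero n := ⟨hn⟩
  split_ifs with h
  · have hker : Nat.card (nsmulAddMonoidHom (α := ZMod n) p).ker = p := by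
      rw [IsAddCyclic.card_nsmulAddMonoidHom_ker, Nat.card_zmod]
      exact Nat.gcd_eq_right ((Dvd.intro_left _ (pow_succ p a).symm).trans h)
    refine Eq.trans (Nat.card_congr (Equiv.subtypeEquivRight fun x => ?_)) hker
    rw [AddMonoidHom.mem_ker, nsmulAddMonoidHom_apply, and_iff_left_iff_imp]
    intro hx
    obtain ⟨c, hc⟩ := h
    have hx' : n ∣ p * x.val := by
      rw [← ZMod.natCast_eq_zero_iff]
      simpa using hx
    have hdvd : p ^ a ∣ x.val := by
      refine Nat.dvd_of_mul_dvd_mul_left hp.pos ?_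
      rw [← pow_succ']
      exact (Dvd.intro _ hc.symm).trans hx'
    obtain ⟨t, ht⟩ := hdvd
    refine ⟨(t : ZMod n), ?_⟩
    rw [nsmul_eq_mul, ← Nat.cast_mul, ← ht, ZMod.natCast_zmod_val]
  · rw [Nat.card_eq_one_iff_unique]
    refine ⟨⟨?_⟩, ⟨⟨0, by simp, 0, by simp⟩⟩⟩
    suffices H : ∀ x : {x : ZMod n // p • x = 0 ∧ ∃ y : ZMod n, p ^ a • y = x}, x.1 = 0 from
      fun x y => Subtype.ext ((H x).trans (H y).symm)
    rintro ⟨x, hx, y, rfl⟩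
    by_contra hne
    refine h ?_
    have : addOrderOf y = p ^ (a + 1) := by
      have : Fact p.Prime := ⟨hp⟩
      refine addOrderOf_eq_prime_pow hne ?_
      rw [pow_succ', mul_nsmul']
      exact hx
    rw [← this]
    simpa using addOrderOf_dvd_natCard y

theorem primaryRank_eq_card {A J : Type*} [AddCommGroup A] [Fintype J] {n : J → ℕ}
    (hn : ∀ j, n j ≠ 0) (e : A ≃+ ∀ j, ZMod (n j)) {p : ℕ} (hp : p.Prime) (a : ℕ) :
    primaryRank A p a = (Finset.univ.filter fun j => p ^ (a + 1) ∣ n j).card := by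
  rw [primaryRank_congr e, primaryRank, card_nsmul_eq_zero_mem_range_pi]
  simp_rw [card_nsmul_eq_zero_mem_range_zmod hp (hn _)]
  rw [Finset.prod_ite, Finset.prod_const, Finset.prod_const_one, mul_one, hp.factorization_pow]
  simp

theorem exists_addEquiv_pi_zmod (A : Type*) [AddCommGroup A] [Finite A] :
    ∃ (J : Type) (_ : Fintype J) (n : J → ℕ), (∀ j, n j = 1 ∨ IsPrimePow (n j)) ∧
      Nonempty (A ≃+ ∀ j, ZMod (n j)) := by
  obtain ⟨J, hJ, p, hp, k, ⟨e⟩⟩ := AddCommGroup.equiv_directSum_zmod_of_finite A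
  refine ⟨J, hJ, fun j => p j ^ k j, fun j => ?_, ⟨e.trans (DirectSum.addEquivProd _)⟩⟩
  rcases eq_or_ne (k j) 0 with h | h
  · exact Or.inl (by simp [h])
  · exact Or.inr ((hp j).isPrimePow.pow h)

/-- A product of cyclic groups, with the factors grouped by their orders. -/
def piZModEquivFiber {J : Type*} (n : J → ℕ) :
    (∀ j, ZMod (n j)) ≃+ ∀ v : ℕ, {j // n j = v} → ZMod v where
  toFun f _ j := j.2 ▸ f j.1
  invFun g j := g (n j) ⟨j, rfl⟩
  left_inv _ := rfl
  right_inv g := by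
    funext v ⟨j, hj⟩
    subst hj
    rfl
  map_add' f g := by
    funext v ⟨j, hj⟩
    subst hj
    rfl

theorem card_primePow_fiber {A J : Type*} [AddCommGroup A] [Fintype J] {n : J → ℕ}
    (hn : ∀ j, n j = 1 ∨ IsPrimePow (n j)) (e : A ≃+ ∀ j, ZMod (n j)) {p : ℕ} (hp : p.Prime)
    (a : ℕ) :
    Nat.card {j // n j = p ^ (a + 1)} = primaryRank A p a - primaryRank A p (a + 1) := by
  classical
  have hn0 : ∀ j, n j ≠ 0 := fun j => (hn j).elim (fun h => by simp [h]) IsPrimePow.ne_zero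
  rw [primaryRank_eq_card hn0 e hp, primaryRank_eq_card hn0 e hp, Nat.card_eq_fintype_card,
    Fintype.card_subtype, ← Finset.card_sdiff_of_subset]
  · congr 1
    ext j
    simp only [Finset.mem_filter, Finset.mem_sdiff, Finset.mem_univ, true_and]
    refine ⟨fun h => ?_, fun ⟨h₁, h₂⟩ => ?_⟩
    · rw [h, Nat.pow_dvd_pow_iff_le_right hp.one_lt, Nat.pow_dvd_pow_iff_le_right hp.one_lt]
      omega
    · rcases hn j with h | h
      · rw [h, Nat.dvd_one] at h₁
        exact absurd h₁ (Nat.one_lt_pow a.succ_ne_zero hp.one_lt).ne'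
      · obtain ⟨r, k, hr, hk, hrk⟩ := (isPrimePow_nat_iff _).mp h
        rw [← hrk] at h₁ h₂ ⊢
        obtain rfl : p = r :=
          (Nat.prime_dvd_prime_iff_eq hp hr).mp
            (hp.dvd_of_dvd_pow ((dvd_pow_self p a.succ_ne_zero).trans h₁))
        rw [Nat.pow_dvd_pow_iff_le_right hp.one_lt] at h₁ h₂
        congr 1
        omega
  · intro j
    simp only [Finset.mem_filter, Finset.mem_univ, true_and]
    exact (pow_dvd_pow p (Nat.le_succ _)).trans

/-- Finite abelian groups with the same primary ranks are isomorphic. -/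
theorem nonempty_addEquiv_of_primaryRank_eq {A B : Type*} [AddCommGroup A] [AddCommGroup B]
    [Finite A] [Finite B]
    (h : ∀ p : ℕ, p.Prime → ∀ a, primaryRank A p a = primaryRank B p a) : Nonempty (A ≃+ B) := by
  obtain ⟨J, _, n, hn, ⟨e⟩⟩ := exists_addEquiv_pi_zmod A
  obtain ⟨K, _, l, hl, ⟨f⟩⟩ := exists_addEquiv_pi_zmod B
  have key (v : ℕ) : Nonempty (({j // n j = v} → ZMod v) ≃+ ({j // l j = v} → ZMod v)) := by
    by_cases hv : IsPrimePow v
    · obtain ⟨p, k, hp, hk, rfl⟩ := (isPrimePow_nat_iff _).mp hv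
      obtain ⟨a, rfl⟩ := Nat.exists_eq_succ_of_ne_zero hk.ne'
      have hc : Nat.card {j // n j = p ^ (a + 1)} = Nat.card {j // l j = p ^ (a + 1)} := by
        rw [card_primePow_fiber hn e hp, card_primePow_fiber hl f hp, h p hp, h p hp]
      exact ⟨(AddEquiv.refl _).arrowCongr (Finite.card_eq.mp hc).some⟩
    · by_cases h1 : v = 1
      · subst h1
        have : Subsingleton (ZMod 1) := inferInstanceAs (Subsingleton (Fin 1))
        exact ⟨⟨Equiv.ofUnique _ _, fun _ _ => Subsingleton.elim _ _⟩⟩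
      · have : IsEmpty {j // n j = v} := ⟨fun j => (hn j.1).elim (fun h => h1 (j.2 ▸ h))
          fun h => hv (j.2 ▸ h)⟩
        have : IsEmpty {j // l j = v} := ⟨fun j => (hl j.1).elim (fun h => h1 (j.2 ▸ h))
          fun h => hv (j.2 ▸ h)⟩
        exact ⟨⟨Equiv.ofUnique _ _, fun _ _ => Subsingleton.elim _ _⟩⟩
  exact ⟨e.trans ((piZModEquivFiber n).trans ((AddEquiv.piCongrRight fun v => (key v).some).trans
    ((piZModEquivFiber l).symm.trans f.symm)))⟩

theorem primaryRank_antitone {A : Type*} [AddCommGroup A] [Finite A] {p : ℕ} (hp : p.Prime) :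
    Antitone (primaryRank A p) := by
  obtain ⟨J, _, n, hn, ⟨e⟩⟩ := exists_addEquiv_pi_zmod A
  have hn0 : ∀ j, n j ≠ 0 := fun j => (hn j).elim (fun h => by simp [h]) IsPrimePow.ne_zero
  intro a b hab
  rw [primaryRank_eq_card hn0 e hp, primaryRank_eq_card hn0 e hp]
  refine Finset.card_le_card fun j => ?_
  simp only [Finset.mem_filter, Finset.mem_univ, true_and]
  exact (pow_dvd_pow p (Nat.succ_le_succ hab)).trans

theorem primaryRank_natCard {A : Type*} [AddCommGroup A] [Finite A] {p : ℕ} (hp : p.Prime) :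
    primaryRank A p (Nat.card A) = 0 := by
  obtain ⟨J, _, n, hn, ⟨e⟩⟩ := exists_addEquiv_pi_zmod A
  have hn0 : ∀ j, n j ≠ 0 := fun j => (hn j).elim (fun h => by simp [h]) IsPrimePow.ne_zero
  rw [primaryRank_eq_card hn0 e hp, Finset.card_eq_zero, Finset.filter_eq_empty_iff]
  intro j _ hj
  have hle : n j ≤ Nat.card A := by
    rw [Nat.card_congr e.toEquiv, Nat.card_pi]
    simp only [Nat.card_zmod]
    exact Nat.le_of_dvd (Finset.prod_pos fun i _ => (hn0 i).bot_lt)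
      (Finset.dvd_prod_of_mem _ (Finset.mem_univ j))
  have hlt := Nat.lt_pow_self (n := Nat.card A + 1) hp.one_lt
  have := Nat.le_of_dvd (hn0 j).bot_lt hj
  omega

theorem sum_Ici_sub_succ {M : ℕ} (f : Fin M → ℕ) (hf : Antitone f) (i₀ : Fin M) :
    ∑ i ∈ Finset.Ici i₀, (if h : (i : ℕ) + 1 < M then f i - f ⟨(i : ℕ) + 1, h⟩ else f i) =
      f i₀ := by
  obtain ⟨k, hk⟩ := i₀
  induction hd : M - k generalizing k with
  | zero => omega
  | succ d ih =>
    rw [← Finset.Ioi_insert, Finset.sum_insert (by simp)]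
    by_cases h : k + 1 < M
    · have hIoi : Finset.Ioi (⟨k, hk⟩ : Fin M) = Finset.Ici ⟨k + 1, h⟩ := by
        ext i
        simp [Fin.lt_def, Fin.le_def]
      have := hf (show (⟨k, hk⟩ : Fin M) ≤ ⟨k + 1, h⟩ from Nat.le_succ k)
      rw [hIoi, ih (k + 1) h (by omega), dif_pos h]
      exact Nat.sub_add_cancel this
    · have hIoi : Finset.Ioi (⟨k, hk⟩ : Fin M) = ∅ := by
        ext i
        simp only [Finset.mem_Ioi, Fin.lt_def, Finset.notMem_empty, iff_false]
        omega
      rw [hIoi, Finset.sum_empty, dif_neg h, add_zero]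

theorem prime_pow_dvd_finset_lcm_iff {ι : Type*} {s : Finset ι} {f : ι → ℕ} {p k : ℕ}
    (hp : p.Prime) (hf : ∀ i ∈ s, f i ≠ 0) (hk : k ≠ 0) :
    p ^ k ∣ s.lcm f ↔ ∃ i ∈ s, p ^ k ∣ f i := by
  classical
  induction s using Finset.induction_on with
  | empty => simp [hk, hp.ne_one]
  | insert a s _ ih =>
    rw [Finset.forall_mem_insert] at hf
    have hs : s.lcm f ≠ 0 := by
      rw [Ne, Finset.lcm_eq_zero_iff]
      simpa using hf.2
    rw [Finset.lcm_insert, Finset.exists_mem_insert, ← ih hf.2]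
    change p ^ k ∣ Nat.lcm _ _ ↔ _
    rw [hp.pow_dvd_iff_le_factorization (Nat.lcm_ne_zero hf.1 hs),
      hp.pow_dvd_iff_le_factorization hf.1, hp.pow_dvd_iff_le_factorization hs,
      Nat.factorization_lcm hf.1 hs, Finsupp.sup_apply, le_sup_iff]

theorem eq_add_of_forall_eq_succ {f : ℕ → ℕ} {a c : ℕ} (h : ∀ t < c, f (a + t) = f (a + t + 1)) :
    f a = f (a + c) := by
  induction c with
  | zero => rfl
  | succ c ih => exact (ih fun t ht => h t (by omega)).trans (h c (by omega))

/-- A product of powers of cyclic groups, written as a single product. -/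
def piPowEquivSigma {ι : Type*} (c d : ι → ℕ) :
    (∀ i, Fin (c i) → ZMod (d i)) ≃+ ∀ s : Σ i, Fin (c i), ZMod (d s.1) where
  toEquiv := (Equiv.piCurry fun i (_ : Fin (c i)) => ZMod (d i)).symm
  map_add' _ _ := rfl

theorem primaryRank_pi_pow {ι : Type*} [Fintype ι] (c d : ι → ℕ) (hd : ∀ i, d i ≠ 0) {p : ℕ}
    (hp : p.Prime) (a : ℕ) :
    primaryRank (∀ i, Fin (c i) → ZMod (d i)) p a =
      ∑ i with p ^ (a + 1) ∣ d i, c i := by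
  rw [primaryRank_eq_card (n := fun s : Σ i, Fin (c i) => d s.1) (fun s => hd s.1) (piPowEquivSigma c d) hp, Finset.card_filter,
    Fintype.sum_sigma, Finset.sum_filter]
  exact Finset.sum_congr rfl fun i _ => by by_cases h : p ^ (a + 1) ∣ d i <;> simp [h]

/-- If the primary ranks of `A` at `p` drop only at exponents represented in `q`, then they are
computed by the first term of `q` divisible by `p ^ (a + 1)`. -/
theorem primaryRank_eq_of_first_dvd {A : Type*} [AddCommGroup A] [Finite A] {M : ℕ}
    {q : Fin M → ℕ} {r : ℕ → ℕ} (hr : Antitone fun i => r (q i)) {p : ℕ} (hp : p.Prime)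
    (hrank : ∀ a, r (p ^ (a + 1)) = primaryRank A p a)
    (hstep : ∀ a, (∀ i, q i ≠ p ^ (a + 1)) → primaryRank A p a = primaryRank A p (a + 1))
    {a b : ℕ} {i₀ : Fin M} (hab : a ≤ b) (hi₀ : q i₀ = p ^ (b + 1))
    (hfirst : ∀ i, p ^ (a + 1) ∣ q i → i₀ ≤ i) :
    primaryRank A p a = r (q i₀) := by
  classical
  have hex : ∃ t, ∃ i, q i = p ^ (a + t + 1) := ⟨b - a, i₀, by rw [hi₀]; congr 1; omega⟩
  have hconst : primaryRank A p a = primaryRank A p (a + Nat.find hex) :=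
    eq_add_of_forall_eq_succ fun t ht => hstep _ fun i hi => Nat.find_min hex ht ⟨i, hi⟩
  obtain ⟨i, hi⟩ := Nat.find_spec hex
  refine le_antisymm ?_ ?_
  · rw [hconst, ← hrank, ← hi]
    exact hr (hfirst i (hi ▸ pow_dvd_pow p (by omega)))
  · rw [hi₀, hrank]
    exact primaryRank_antitone hp hab

theorem statement19 (m : ℕ) (hm : 3 ≤ m) (M : ℕ) (hM : 1 ≤ M) (q : Fin M → ℕ)
    (hpp : ∀ i, IsPrimePow (q i)) (hinj : Function.Injective q)
    (hcomplete : ∀ p α : ℕ, p.Prime → 1 ≤ α → (∀ i, q i ≠ p ^ α) →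
      prm m (p ^ α) = prm m (p ^ (α + 1)))
    (hord : ∀ i j : Fin M, i ≤ j → prm m (q j) ≤ prm m (q i)) :
    Nonempty ((ZMod m)ˣ ≃*
      Multiplicative (∀ i : Fin M,
        Fin (if h : (i : ℕ) + 1 < M then prm m (q i) - prm m (q ⟨(i : ℕ) + 1, h⟩)
             else prm m (q i)) →
          ZMod ((Finset.Iic i).lcm q))) := by
  classical
  have : NeZero m := ⟨by omega⟩
  have hlcm (i : Fin M) : (Finset.Iic i).lcm q ≠ 0 := by
    rw [Ne, Finset.lcm_eq_zero_iff]
    simp [(hpp _).ne_zero]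
  have (i : Fin M) : NeZero ((Finset.Iic i).lcm q) := ⟨hlcm i⟩
  refine (nonempty_addEquiv_of_primaryRank_eq (A := Additive (ZMod m)ˣ) fun p hp a => ?_).map
    AddEquiv.toMultiplicativeRight
  rw [primaryRank_pi_pow _ _ hlcm hp]
  have hstep (a : ℕ) (h : ∀ i, q i ≠ p ^ (a + 1)) :
      primaryRank (Additive (ZMod m)ˣ) p a = primaryRank (Additive (ZMod m)ˣ) p (a + 1) := by
    rw [← prm_prime_pow_succ m hp, ← prm_prime_pow_succ m hp]
    exact hcomplete p (a + 1) hp (Nat.le_add_left _ _) h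
  have hdvd (i : Fin M) : p ^ (a + 1) ∣ (Finset.Iic i).lcm q ↔ ∃ j ≤ i, p ^ (a + 1) ∣ q j := by
    rw [prime_pow_dvd_finset_lcm_iff hp (fun j _ => (hpp j).ne_zero) a.succ_ne_zero]
    simp only [Finset.mem_Iic]
  simp only [hdvd]
  rcases (Finset.univ.filter fun i => p ^ (a + 1) ∣ q i).eq_empty_or_nonempty with h | h
  · have hnone (i : Fin M) : ¬ p ^ (a + 1) ∣ q i := by
      simpa using Finset.filter_eq_empty_iff.mp h (Finset.mem_univ i)
    rw [Finset.filter_false_of_mem fun i _ ⟨j, _, hj⟩ => hnone j hj, Finset.sum_empty]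
    have hconst := eq_add_of_forall_eq_succ (f := primaryRank (Additive (ZMod m)ˣ) p) (a := a)
      (c := Nat.card (Additive (ZMod m)ˣ)) fun t _ => hstep _ fun i hi =>
        hnone i (hi ▸ pow_dvd_pow p (by omega))
    rw [hconst]
    exact Nat.le_zero.mp ((primaryRank_antitone hp (Nat.le_add_left _ _)).trans_eq
      (primaryRank_natCard hp))
  · obtain ⟨i₀, hi₀, hmin⟩ := Finset.exists_minimal h
    simp only [Finset.mem_filter, Finset.mem_univ, true_and] at hi₀ hmin
    have hfirst (i : Fin M) (hi : p ^ (a + 1) ∣ q i) : i₀ ≤ i :=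
      (le_total i₀ i).elim id (hmin hi)
    have hset : (Finset.univ.filter fun i => ∃ j ≤ i, p ^ (a + 1) ∣ q j) = Finset.Ici i₀ := by
      ext i
      simp only [Finset.mem_filter, Finset.mem_univ, true_and, Finset.mem_Ici]
      exact ⟨fun ⟨j, hji, hj⟩ => (hfirst j hj).trans hji, fun hi => ⟨i₀, hi, hi₀⟩⟩
    rw [hset, sum_Ici_sub_succ (fun i => prm m (q i)) hord]
    obtain ⟨r, k, hr, hk, hrk⟩ := (isPrimePow_nat_iff _).mp (hpp i₀)
    obtain ⟨b, rfl⟩ := Nat.exists_eq_succ_of_ne_zero hk.ne'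
    rw [← hrk] at hi₀
    obtain rfl : p = r := (Nat.prime_dvd_prime_iff_eq hp hr).mp
      (hp.dvd_of_dvd_pow ((dvd_pow_self p a.succ_ne_zero).trans hi₀))
    rw [Nat.pow_dvd_pow_iff_le_right hp.one_lt] at hi₀
    exact primaryRank_eq_of_first_dvd hord hp (prm_prime_pow_succ m hp) hstep (by omega)
      hrk.symm hfirst

end
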